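/- Let d ≥ 2, n ≥ 1 and let α be an integer with max{d, n} ≤ α ≤ dn. Then every X ∈ 𝔹^{d×n}_{≠0} with ‖X‖₀ = α satisfies C_D(X) · L(α, d) ≤ U(α, d, n) · C_P(X) (i.e., C_P(X)/C_D(X) ≥ L(α, d)/U(α, d, n)). Moreover, this bound is tight: there exists X ∈ 𝔹^{d×n}_{≠0} with ‖X‖₀ = α such that simultaneously C_P(X) = L(α, d) and C_D(X) = U(α, d, n). -/

import Mathlib

open scoped BigOperators

/-- Number of nonzero entries of row `i` of `X`. -/
noncomputable def nnzRow {d n : ℕ} (X : Matrix (Fin d) (Fin n) ℝ) (i : Fin d) : ℕ :=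
  (Finset.univ.filter fun j => X i j ≠ 0).card

/-- Number of nonzero entries of column `j` of `X`. -/
noncomputable def nnzCol {d n : ℕ} (X : Matrix (Fin d) (Fin n) ℝ) (j : Fin n) : ℕ :=
  (Finset.univ.filter fun i => X i j ≠ 0).card

/-- Total number of nonzero entries of `X`. -/
noncomputable def nnz {d n : ℕ} (X : Matrix (Fin d) (Fin n) ℝ) : ℕ :=
  ∑ i, nnzRow X i

/-- `X` has all its entries in `{−1, 0, 1}`. -/
def IsBinary {d n : ℕ} (X : Matrix (Fin d) (Fin n) ℝ) : Prop :=
  ∀ i j, X i j = -1 ∨ X i j = 0 ∨ X i j = 1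

/-- `X` has no zero row and no zero column. -/
def NoZeroRowCol {d n : ℕ} (X : Matrix (Fin d) (Fin n) ℝ) : Prop :=
  (∀ i, ∃ j, X i j ≠ 0) ∧ (∀ j, ∃ i, X i j ≠ 0)

/-- For binary matrices, `C_P(X) = ∑ᵢ ‖X₍i:₎‖₀²`. -/
noncomputable def CP {d n : ℕ} (X : Matrix (Fin d) (Fin n) ℝ) : ℕ :=
  ∑ i, nnzRow X i ^ 2

/-- For binary matrices, `C_D(X) = ∑ⱼ ‖X₍:j₎‖₀²`. -/
noncomputable def CD {d n : ℕ} (X : Matrix (Fin d) (Fin n) ℝ) : ℕ :=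
  ∑ j, nnzCol X j ^ 2

/-- `ā_b = b⌊a/b⌋`: `a` rounded down to the closest multiple of `b`. -/
def rnd (a b : ℕ) : ℕ := b * (a / b)

/-- `L(α, n) = (1/n)(ᾱ_n² + (α − ᾱ_n)(2ᾱ_n + n))`. -/
noncomputable def Lfun (α n : ℕ) : ℝ :=
  (1 / (n : ℝ)) * ((rnd α n : ℝ) ^ 2 +
    ((α - rnd α n : ℕ) : ℝ) * (2 * (rnd α n : ℝ) + (n : ℝ)))

/-- `U(α, d, n) = (d+1)·(α−n)̄_{d−1} + n − 1 + (α − n + 1 − (α−n)̄_{d−1})²`. -/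
noncomputable def Ufun (α d n : ℕ) : ℝ :=
  ((d : ℝ) + 1) * (rnd (α - n) (d - 1) : ℝ) + (n : ℝ) - 1 +
    ((α - n + 1 - rnd (α - n) (d - 1) : ℕ) : ℝ) ^ 2


/-- Maximal sum of squares of parts `≤ m` with total `E`. -/
def fmax (m E : ℕ) : ℕ := (E / m) * m ^ 2 + (E % m) ^ 2

theorem fmax_eq (m q r : ℕ) (hr : r < m) : fmax m (q * m + r) = q * m ^ 2 + r ^ 2 := by
  have h1 : (q * m + r) / m = q := by
    rw [Nat.div_eq_iff (by omega)]
    constructor <;> omega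
  have h2 : (q * m + r) % m = r := by
    rw [mul_comm, Nat.mul_add_mod, Nat.mod_eq_of_lt hr]
  rw [fmax, h1, h2]

theorem fmax_step (m E e : ℕ) (hm : 0 < m) (he : e ≤ m) :
    fmax m E + e ^ 2 ≤ fmax m (E + e) := by
  obtain ⟨q, r, hr, rfl⟩ : ∃ q r, r < m ∧ E = q * m + r :=
    ⟨E / m, E % m, Nat.mod_lt _ hm, by rw [mul_comm]; exact (Nat.div_add_mod E m).symm⟩
  rw [fmax_eq m q r hr]
  by_cases h : r + e < m
  · rw [add_assoc (q * m), fmax_eq m q (r + e) h]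
    nlinarith [Nat.zero_le (r * e)]
  · obtain ⟨s, hs⟩ : ∃ s, r + e = m + s := ⟨r + e - m, by omega⟩
    have : q * m + r + e = (q + 1) * m + s := by linarith
    rw [this, fmax_eq m (q + 1) s (by omega)]
    obtain ⟨u, rfl⟩ : ∃ u, m = e + u := ⟨m - e, by omega⟩
    have : r = u + s := by omega
    subst this
    obtain ⟨v, rfl⟩ : ∃ v, e = s + v := ⟨e - s, by omega⟩
    nlinarith [Nat.zero_le (u * v)]

theorem sum_sq_le_fmax {ι : Type*} (m : ℕ) (hm : 0 < m) (s : Finset ι) (e : ι → ℕ)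
    (he : ∀ i, e i ≤ m) : ∑ i ∈ s, e i ^ 2 ≤ fmax m (∑ i ∈ s, e i) := by
  classical
  induction s using Finset.induction_on with
  | empty => simp
  | insert a s ha ih =>
    rw [Finset.sum_insert ha, Finset.sum_insert ha, add_comm, add_comm (e a)]
    exact le_trans (by omega) (fmax_step m _ _ hm (he a))

theorem sum_sq_eq_fmax (m E : ℕ) (hm : 0 < m) (n : ℕ) :
    ∑ j ∈ Finset.range n, (min ((j + 1) * m) E - min (j * m) E) ^ 2 = fmax m (min (n * m) E) := by
  induction n with
  | zero => simp [fmax]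
  | succ k ih =>
    rw [Finset.sum_range_succ, ih]
    have hk : (k + 1) * m = k * m + m := by ring
    have e0 := fmax_eq m k 0 hm
    have e1 := fmax_eq m (k + 1) 0 hm
    rw [hk] at e1
    rw [hk]
    simp only [add_zero] at e0 e1
    rcases le_total (k * m + m) E with h | h
    · rw [min_eq_left h, min_eq_left (by omega), e0, e1, Nat.add_sub_cancel_left]
      ring
    · rw [min_eq_right h]
      rcases le_or_gt E (k * m) with h2 | h2
      · rw [min_eq_right h2]; simp
      · rw [min_eq_left h2.le, e0]
        rcases h.eq_or_lt with h3 | h3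
        · rw [h3, e1, Nat.add_sub_cancel_left]; ring
        · obtain ⟨r, rfl⟩ : ∃ r, E = k * m + r := ⟨E - k * m, by omega⟩
          rw [fmax_eq m k r (by omega), Nat.add_sub_cancel_left]; ring

theorem sum_div_shift (d s : ℕ) (hd : 0 < d) : ∑ i ∈ Finset.range d, (s + i) / d = s := by
  induction s with
  | zero =>
    apply Finset.sum_eq_zero
    intro i hi
    rw [zero_add]
    exact Nat.div_eq_of_lt (Finset.mem_range.1 hi)
  | succ s ih =>
    have h1 := Finset.sum_range_succ (fun i => (s + i) / d) d
    have h2 := Finset.sum_range_succ' (fun i => (s + i) / d) d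
    rw [h1, ih] at h2
    have h3 : (s + d) / d = s / d + 1 := Nat.add_div_right s hd
    have h4 : ∑ i ∈ Finset.range d, (s + 1 + i) / d = ∑ i ∈ Finset.range d, (s + (i + 1)) / d :=
      Finset.sum_congr rfl fun i _ => by congr 1; omega
    simp only [add_zero] at h2
    omega

theorem Lfun_eq (α d : ℕ) (hd : 0 < d) :
    Lfun α d = (2 * ((α / d : ℕ) : ℝ) + 1) * α - d * (α / d : ℕ) * ((α / d : ℕ) + 1) := by
  have hle : d * (α / d) ≤ α := Nat.mul_div_le α d
  have : (d : ℝ) ≠ 0 := by positivity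
  unfold Lfun rnd
  rw [Nat.cast_sub hle]
  push_cast [-Nat.cast_div_charZero]
  field_simp
  ring

theorem Ufun_eq (α d n : ℕ) (hd : 2 ≤ d) (h : n ≤ α) :
    Ufun α d n = ((fmax (d - 1) (α - n) + 2 * (α - n) + n : ℕ) : ℝ) := by
  obtain ⟨m, rfl⟩ : ∃ m, d = m + 1 := ⟨d - 1, by omega⟩
  obtain ⟨E, rfl⟩ : ∃ E, α = n + E := ⟨α - n, by omega⟩
  simp only [Nat.add_sub_cancel, Nat.add_sub_cancel_left]
  have hm : 0 < m := by omega
  obtain ⟨q, r, hr, rfl⟩ : ∃ q r, r < m ∧ E = q * m + r :=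
    ⟨E / m, E % m, Nat.mod_lt _ hm, by rw [mul_comm]; exact (Nat.div_add_mod E m).symm⟩
  have h1 : (q * m + r) / m = q := by
    rw [Nat.div_eq_iff (by omega)]
    constructor <;> omega
  have h2 : q * m + r + 1 - m * q = r + 1 := by rw [mul_comm]; omega
  unfold Ufun rnd
  simp only [Nat.add_sub_cancel, Nat.add_sub_cancel_left]
  rw [h1, h2, fmax_eq m q r hr]
  push_cast
  ring

theorem nnz_eq_col {d n : ℕ} (X : Matrix (Fin d) (Fin n) ℝ) : nnz X = ∑ j, nnzCol X j := by
  simp only [nnz, nnzRow, nnzCol, Finset.card_filter]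
  exact Finset.sum_comm

theorem sum_sq_ge {ι : Type*} (s : Finset ι) (r : ι → ℕ) (q : ℕ) :
    (2 * (q : ℝ) + 1) * ((∑ i ∈ s, r i : ℕ) : ℝ) - s.card * q * (q + 1)
      ≤ ((∑ i ∈ s, r i ^ 2 : ℕ) : ℝ) := by
  have h : ∀ i ∈ s, (2 * (q : ℝ) + 1) * (r i : ℝ) - q * (q + 1) ≤ (r i : ℝ) ^ 2 := by
    intro i _
    rcases le_or_gt (r i) q with h | h
    · have : (r i : ℝ) ≤ q := by exact_mod_cast h
      nlinarith
    · have : (q : ℝ) + 1 ≤ r i := by exact_mod_cast h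
      nlinarith
  have := Finset.sum_le_sum h
  rw [Finset.sum_sub_distrib, ← Finset.mul_sum, Finset.sum_const, nsmul_eq_mul] at this
  push_cast
  linarith

theorem sum_sq_eq {ι : Type*} (s : Finset ι) (r : ι → ℕ) (q : ℕ)
    (hr : ∀ i ∈ s, r i = q ∨ r i = q + 1) :
    ((∑ i ∈ s, r i ^ 2 : ℕ) : ℝ) =
    (2 * (q : ℝ) + 1) * ((∑ i ∈ s, r i : ℕ) : ℝ) - s.card * q * (q + 1) := by
  have h : ∀ i ∈ s, (r i : ℝ) ^ 2 = (2 * (q : ℝ) + 1) * (r i : ℝ) - q * (q + 1) := by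
    intro i hi
    rcases hr i hi with h | h
    · rw [h]; ring
    · rw [h]; push_cast; ring
  have := Finset.sum_congr rfl h
  rw [Finset.sum_sub_distrib, ← Finset.mul_sum, Finset.sum_const, nsmul_eq_mul] at this
  push_cast
  linarith

theorem sum_col_sq {ι : Type*} (s : Finset ι) (c : ι → ℕ) :
    ∑ j ∈ s, (c j + 1) ^ 2 = ∑ j ∈ s, c j ^ 2 + 2 * ∑ j ∈ s, c j + s.card := by
  rw [Finset.mul_sum, Finset.card_eq_sum_ones, ← Finset.sum_add_distrib, ← Finset.sum_add_distrib]
  exact Finset.sum_congr rfl fun j _ => by ring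

theorem CP_ge {d n α : ℕ} (hd : 2 ≤ d) (X : Matrix (Fin d) (Fin n) ℝ) (hX : nnz X = α) :
    Lfun α d ≤ (CP X : ℝ) := by
  rw [Lfun_eq α d (by omega), CP]
  have := sum_sq_ge Finset.univ (nnzRow X) (α / d)
  rw [Finset.card_univ, Fintype.card_fin] at this
  rw [← hX] at this ⊢
  exact this

theorem CD_le {d n α : ℕ} (hd : 2 ≤ d) (hα : n ≤ α) (X : Matrix (Fin d) (Fin n) ℝ)
    (hz : NoZeroRowCol X) (hX : nnz X = α) :
    (CD X : ℝ) ≤ Ufun α d n := by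
  rw [Ufun_eq α d n hd hα, CD, Nat.cast_le]
  have hc : ∀ j, 1 ≤ nnzCol X j := by
    intro j
    obtain ⟨i, hi⟩ := hz.2 j
    exact Finset.card_pos.2 ⟨i, by simp [hi]⟩
  have hc2 : ∀ j, nnzCol X j ≤ d := by
    intro j
    exact (Finset.card_le_univ _).trans (by simp)
  obtain ⟨c, hcc⟩ : ∃ c : Fin n → ℕ, ∀ j, nnzCol X j = c j + 1 :=
    ⟨fun j => nnzCol X j - 1, fun j => (Nat.sub_add_cancel (hc j)).symm⟩
  rw [nnz_eq_col] at hX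
  simp only [hcc] at hX hc2 ⊢
  rw [Finset.sum_add_distrib] at hX
  simp at hX
  rw [sum_col_sq, Finset.card_univ, Fintype.card_fin]
  have := sum_sq_le_fmax (d - 1) (by omega) Finset.univ c (fun j => by have := hc2 j; omega)
  have h3 : α - n = ∑ j, c j := by omega
  rw [h3]
  omega

theorem exists_tight (d n α : ℕ) (hd : 2 ≤ d) 
    (hα₁ : d ≤ α) (hα₃ : n ≤ α) (hα₂ : α ≤ d * n) :
    ∃ X : Matrix (Fin d) (Fin n) ℝ,
      IsBinary X ∧ NoZeroRowCol X ∧ nnz X = α ∧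
        (CP X : ℝ) = Lfun α d ∧ (CD X : ℝ) = Ufun α d n := by
  obtain ⟨m, rfl⟩ : ∃ m, d = m + 1 := ⟨d - 1, by omega⟩
  obtain ⟨E, rfl⟩ : ∃ E, α = n + E := ⟨α - n, by omega⟩
  have hm : 0 < m := by omega
  have hE : E ≤ n * m := by nlinarith
  obtain ⟨e, he⟩ : ∃ e : ℕ → ℕ, ∀ j, e j = min ((j + 1) * m) E - min (j * m) E := ⟨_, fun _ => rfl⟩
  obtain ⟨S, hS⟩ : ∃ S : ℕ → ℕ, ∀ j, S j = j + min (j * m) E := ⟨_, fun _ => rfl⟩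
  have hSe : ∀ j, S (j + 1) = S j + (e j + 1) := by
    intro j
    rw [hS, hS, he]
    have : (j + 1) * m = j * m + m := by ring
    omega
  have hem : ∀ j, e j ≤ m := by
    intro j
    rw [he]
    have : (j + 1) * m = j * m + m := by ring
    omega
  have hS0 : S 0 = 0 := by simp [hS]
  have hSn : S n = n + E := by rw [hS, min_eq_right hE]
  have hesq : ∑ j ∈ Finset.range n, e j ^ 2 = fmax m E := by
    simp only [he]
    rw [sum_sq_eq_fmax m E hm n, min_eq_right hE]
  have hesum : ∀ k, ∑ j ∈ Finset.range k, (e j + 1) = S k := by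
    intro k
    induction k with
    | zero => simp [hS0]
    | succ k ih => rw [Finset.sum_range_succ, ih, hSe]
  -- indicator
  obtain ⟨N, hN⟩ : ∃ N : ℕ → ℕ → ℕ, ∀ i s, N i s = (s + i) / (m + 1) := ⟨_, fun _ _ => rfl⟩
  have hNmono : ∀ i j, N i (S j) ≤ N i (S (j + 1)) := by
    intro i j
    rw [hN, hN]
    exact Nat.div_le_div_right (by rw [hSe]; omega)
  have hNstep : ∀ i j, N i (S (j + 1)) ≤ N i (S j) + 1 := by
    intro i j
    rw [hN, hN, ← Nat.add_div_right _ (by omega)]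
    exact Nat.div_le_div_right (by rw [hSe]; have := hem j; omega)
  have hind : ∀ i j, N i (S (j + 1)) =
      N i (S j) + (if N i (S j) < N i (S (j + 1)) then 1 else 0) := by
    intro i j
    have := hNmono i j
    have := hNstep i j
    split_ifs <;> omega
  have hNsum : ∀ s, ∑ i ∈ Finset.range (m + 1), N i s = s := by
    intro s
    simp only [hN]
    exact sum_div_shift (m + 1) s (by omega)
  let X : Matrix (Fin (m + 1)) (Fin n) ℝ :=
    fun i j => if N i (S j) < N i (S (j + 1)) then 1 else 0
  have hX : ∀ i j, X i j ≠ 0 ↔ N i (S j) < N i (S (j + 1)) := by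
    intro i j
    simp [X]
  have hrow : ∀ i, nnzRow X i = (n + E + i) / (m + 1) := by
    intro i
    unfold nnzRow
    simp only [hX]
    rw [Finset.card_filter,
      Fin.sum_univ_eq_sum_range (fun j => if N i (S j) < N i (S (j + 1)) then 1 else 0) n]
    have key : ∀ k, ∑ j ∈ Finset.range k, (if N i (S j) < N i (S (j + 1)) then 1 else 0)
        = N i (S k) := by
      intro k
      induction k with
      | zero =>
        rw [hS0, hN, zero_add, Nat.div_eq_of_lt i.2]
        simp
      | succ k ih => rw [Finset.sum_range_succ, ih, ← hind]
    rw [key, hSn, hN]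
  have hcol : ∀ j, nnzCol X j = e j + 1 := by
    intro j
    unfold nnzCol
    simp only [hX]
    rw [Finset.card_filter,
      Fin.sum_univ_eq_sum_range (fun i => if N i (S j) < N i (S (j + 1)) then 1 else 0) (m + 1)]
    have h1 := hNsum (S (j + 1))
    rw [Finset.sum_congr rfl (fun i _ => hind i j), Finset.sum_add_distrib, hNsum, hSe] at h1
    rw [← hSe] at h1
    have := hSe j
    omega
  have hnnz : nnz X = n + E := by
    rw [nnz_eq_col]
    simp only [hcol]
    rw [Fin.sum_univ_eq_sum_range (fun j => e j + 1) n, hesum, hSn]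
  refine ⟨X, ?_, ⟨?_, ?_⟩, hnnz, ?_, ?_⟩
  · intro i j
    simp only [X]
    split_ifs <;> simp
  · intro i
    have : 0 < nnzRow X i := by
      rw [hrow]
      exact Nat.div_pos (by omega) (by omega)
    obtain ⟨j, hj⟩ := Finset.card_pos.1 this
    exact ⟨j, (Finset.mem_filter.1 hj).2⟩
  · intro j
    have : 0 < nnzCol X j := by
      rw [hcol]
      omega
    obtain ⟨i, hi⟩ := Finset.card_pos.1 this
    exact ⟨i, (Finset.mem_filter.1 hi).2⟩
  · rw [Lfun_eq _ _ (by omega), CP, sum_sq_eq Finset.univ (nnzRow X) ((n + E) / (m + 1))]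
    · rw [Finset.card_univ, Fintype.card_fin]
      have : ∑ i, nnzRow X i = n + E := hnnz
      rw [this]
    · intro i _
      rw [hrow]
      have h1 : (n + E) / (m + 1) ≤ (n + E + i) / (m + 1) := Nat.div_le_div_right (by omega)
      have h2 : (n + E + i) / (m + 1) ≤ (n + E) / (m + 1) + 1 := by
        rw [← Nat.add_div_right _ (by omega)]
        exact Nat.div_le_div_right (by have := i.2; omega)
      omega
  · rw [Ufun_eq _ _ _ hd hα₃, CD, Nat.cast_inj]
    simp only [hcol]
    rw [Fin.sum_univ_eq_sum_range (fun j => (e j + 1) ^ 2) n, sum_col_sq, hesq]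
    have := hesum n
    rw [Finset.sum_add_distrib, hSn] at this
    simp only [Finset.sum_const, Finset.card_range, smul_eq_mul, mul_one] at this
    simp only [Nat.add_sub_cancel, Nat.add_sub_cancel_left, Finset.card_range]
    have h2 : ∑ j ∈ Finset.range n, e j = E := by omega
    rw [h2]

/-- Every binary `d×n` matrix with no zero row or column and `α` nonzero entries
satisfies `C_D(X) · L(α, d) ≤ U(α, d, n) · C_P(X)`
(i.e. `C_P(X)/C_D(X) ≥ L(α, d)/U(α, d, n)`), and this bound is tight: some such
matrix attains `C_P = L(α, d)` and `C_D = U(α, d, n)` simultaneously. -/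
theorem ratio_lower_bound_tight
    (d n α : ℕ) (hd : 2 ≤ d) (hn : 1 ≤ n)
    (hα₁ : max d n ≤ α) (hα₂ : α ≤ d * n) :
    (∀ X : Matrix (Fin d) (Fin n) ℝ,
      IsBinary X → NoZeroRowCol X → nnz X = α →
        (CD X : ℝ) * Lfun α d ≤ Ufun α d n * (CP X : ℝ)) ∧
    (∃ X : Matrix (Fin d) (Fin n) ℝ,
      IsBinary X ∧ NoZeroRowCol X ∧ nnz X = α ∧
        (CP X : ℝ) = Lfun α d ∧ (CD X : ℝ) = Ufun α d n) := by
  refine ⟨?_, exists_tight d n α hd ((le_max_left _ _).trans hα₁)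
    ((le_max_right _ _).trans hα₁) hα₂⟩
  intro X _ hz hX
  have h1 := CP_ge hd X hX
  have h2 := CD_le hd ((le_max_right _ _).trans hα₁) X hz hX
  calc (CD X : ℝ) * Lfun α d ≤ (CD X : ℝ) * CP X := by gcongr
    _ ≤ Ufun α d n * CP X := by gcongr
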